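/- Let Q, R be symmetric positive definite such that R̂ = R - σ_0² C_0'(A')^D Q A^D C_0 is positive definite, and suppose Z is symmetric positive definite and satisfies the fixed-point equation Z = R^R_{D+1}(Z) for delay D+1. Then Z ⪰ R^{R̂}_D(Z), i.e. Z dominates, in the Loewner order, the value of the delay-D Riccati operator with weight R̂ at Z. (Consequently, by monotone iteration, the delay-D DDARE admits a positive definite solution, so stabilizability for delay D+1 implies stabilizability for delay D.) -/

import Mathlib

open Matrix

noncomputable section

/-- `Ψ^R_D(Z) = B̄'ZB̄ + σ_0² C_0'(A')^D Z A^D C_0 + σ_D² C̄'(A')^D Z A^D C̄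
  + Σ_{h=1}^{D} σ_D² C̄'(A')^{D-h} Q A^{D-h} C̄ + R`. -/
def PsiR {n : ℕ} (A Bb C0 Cb : Matrix (Fin n) (Fin n) ℝ) (σ0 σD : ℝ)
    (Q : Matrix (Fin n) (Fin n) ℝ) (D : ℕ) (R Z : Matrix (Fin n) (Fin n) ℝ) :
    Matrix (Fin n) (Fin n) ℝ :=
  Bbᵀ * Z * Bb + σ0 ^ 2 • (C0ᵀ * (Aᵀ) ^ D * Z * A ^ D * C0) +
    σD ^ 2 • (Cbᵀ * (Aᵀ) ^ D * Z * A ^ D * Cb) +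
    (∑ h ∈ Finset.Icc 1 D, σD ^ 2 • (Cbᵀ * (Aᵀ) ^ (D - h) * Q * A ^ (D - h) * Cb)) + R

/-- The Riccati operator `R^R_D(Z) = A'ZA + Q - A'Z B̄ Ψ^R_D(Z)^{-1} B̄' Z A` of the
restricted system `[A,C_0;B̄,C̄]_D`. -/
def RopR {n : ℕ} (A Bb C0 Cb : Matrix (Fin n) (Fin n) ℝ) (σ0 σD : ℝ)
    (Q : Matrix (Fin n) (Fin n) ℝ) (D : ℕ) (R Z : Matrix (Fin n) (Fin n) ℝ) :
    Matrix (Fin n) (Fin n) ℝ :=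
  Aᵀ * Z * A + Q - Aᵀ * Z * Bb * (PsiR A Bb C0 Cb σ0 σD Q D R Z)⁻¹ * Bbᵀ * Z * A

/-- Matrix inversion is antitone on positive definite matrices. -/
theorem posSemidef_inv_sub_inv {n : ℕ} {X Y : Matrix (Fin n) (Fin n) ℝ} (hX : X.PosDef)
    (hY : Y.PosDef) (h : (Y - X).PosSemidef) : (X⁻¹ - Y⁻¹).PosSemidef := by
  have hXu := (Matrix.isUnit_iff_isUnit_det _).1 hX.isUnit
  have hYu := (Matrix.isUnit_iff_isUnit_det _).1 hY.isUnit
  have hp : ((Y - X) + (Y - X)ᴴ * X⁻¹ * (Y - X)).PosSemidef :=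
    h.add (hX.inv.posSemidef.conjTranspose_mul_mul_same _)
  have hq := hp.conjTranspose_mul_mul_same Y⁻¹
  have hmid : (Y - X) + (Y - X)ᴴ * X⁻¹ * (Y - X) = Y * (X⁻¹ - Y⁻¹) * Y := by
    rw [h.isHermitian.eq]
    simp only [mul_sub, sub_mul, mul_assoc, Matrix.nonsing_inv_mul _ hXu,
      Matrix.nonsing_inv_mul _ hYu, Matrix.mul_nonsing_inv_cancel_left _ _ hXu, mul_one]
    abel
  rw [hmid, hY.inv.isHermitian.eq] at hq
  convert hq using 1
  simp only [mul_assoc, Matrix.mul_nonsing_inv _ hYu, mul_one,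
    Matrix.nonsing_inv_mul_cancel_left _ _ hYu]

/-- A nonnegative multiple of a congruence by `A ^ k * C` preserves positive semidefiniteness. -/
theorem posSemidef_smul_transpose_pow_mul {n : ℕ} (A C : Matrix (Fin n) (Fin n) ℝ) (k : ℕ) (σ : ℝ)
    {M : Matrix (Fin n) (Fin n) ℝ} (hM : M.PosSemidef) :
    (σ ^ 2 • (Cᵀ * Aᵀ ^ k * M * A ^ k * C)).PosSemidef := by
  have h := (hM.conjTranspose_mul_mul_same (A ^ k * C)).smul (sq_nonneg σ)
  simpa only [Matrix.conjTranspose_eq_transpose_of_trivial, Matrix.transpose_mul,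
    Matrix.transpose_pow, mul_assoc] using h

theorem posDef_PsiR {n : ℕ} (A Bb C0 Cb : Matrix (Fin n) (Fin n) ℝ) (σ0 σD : ℝ) (D : ℕ)
    {Q R Z : Matrix (Fin n) (Fin n) ℝ} (hQ : Q.PosSemidef) (hR : R.PosDef) (hZ : Z.PosSemidef) :
    (PsiR A Bb C0 Cb σ0 σD Q D R Z).PosDef := by
  refine Matrix.PosDef.posSemidef_add (((Matrix.PosSemidef.add ?_ ?_).add ?_).add ?_) hR
  · simpa only [Matrix.conjTranspose_eq_transpose_of_trivial] using
      hZ.conjTranspose_mul_mul_same Bb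
  · exact posSemidef_smul_transpose_pow_mul A C0 D σ0 hZ
  · exact posSemidef_smul_transpose_pow_mul A Cb D σD hZ
  · exact Matrix.posSemidef_sum _ fun h _ => posSemidef_smul_transpose_pow_mul A Cb (D - h) σD hQ

theorem PsiR_succ_sub_PsiR {n : ℕ} (A Bb C0 Cb : Matrix (Fin n) (Fin n) ℝ) (σ0 σD : ℝ) (D : ℕ)
    (Q R Z : Matrix (Fin n) (Fin n) ℝ) :
    PsiR A Bb C0 Cb σ0 σD Q (D + 1) R Z -
        PsiR A Bb C0 Cb σ0 σD Q D (R - σ0 ^ 2 • (C0ᵀ * (Aᵀ) ^ D * Q * A ^ D * C0)) Z =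
      σ0 ^ 2 • (C0ᵀ * (Aᵀ) ^ D * (Aᵀ * Z * A + Q - Z) * A ^ D * C0) +
        σD ^ 2 • (Cbᵀ * (Aᵀ) ^ D * (Aᵀ * Z * A + Q - Z) * A ^ D * Cb) := by
  have hsum : ∑ h ∈ Finset.Icc 1 (D + 1),
        σD ^ 2 • (Cbᵀ * (Aᵀ) ^ (D + 1 - h) * Q * A ^ (D + 1 - h) * Cb) =
      σD ^ 2 • (Cbᵀ * (Aᵀ) ^ D * Q * A ^ D * Cb) +
        ∑ h ∈ Finset.Icc 1 D, σD ^ 2 • (Cbᵀ * (Aᵀ) ^ (D - h) * Q * A ^ (D - h) * Cb) := by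
    simp only [← Finset.Ico_add_one_right_eq_Icc, Finset.sum_Ico_eq_sum_range]
    rw [Nat.add_sub_cancel, Nat.add_sub_cancel, Finset.sum_range_succ', add_comm]
    congr 1
    refine Finset.sum_congr rfl fun i _ => ?_
    rw [show D + 1 - (1 + (i + 1)) = D - (1 + i) by lia]
  have hl : Aᵀ ^ (D + 1) = Aᵀ ^ D * Aᵀ := pow_succ _ _
  have hr : A ^ (D + 1) = A * A ^ D := pow_succ' _ _
  unfold PsiR
  rw [hsum, hl, hr]
  simp only [mul_sub, sub_mul, mul_add, add_mul, smul_sub, smul_add, mul_assoc]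
  abel

/-- delay monotonicity of the DDARE.
If `R̂ = R - σ_0² C_0'(A')^D Q A^D C_0` is positive definite and the positive definite `Z`
solves the delay-`(D+1)` DDARE `Z = R^R_{D+1}(Z)`, then `Z ⪰ R^{R̂}_D(Z)`. -/
theorem stmt_11 {n : ℕ} (A Bb C0 Cb : Matrix (Fin n) (Fin n) ℝ) (hA : IsUnit A.det)
    (σ0 σD : ℝ) (hσ0 : 0 ≤ σ0) (hσD : 0 ≤ σD) (D : ℕ)
    (Q R : Matrix (Fin n) (Fin n) ℝ) (hQ : Q.PosDef) (hR : R.PosDef)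
    (hRhat : (R - σ0 ^ 2 • (C0ᵀ * (Aᵀ) ^ D * Q * A ^ D * C0)).PosDef)
    (Z : Matrix (Fin n) (Fin n) ℝ) (hZ : Z.PosDef)
    (hfix : Z = RopR A Bb C0 Cb σ0 σD Q (D + 1) R Z) :
    (Z - RopR A Bb C0 Cb σ0 σD Q D
        (R - σ0 ^ 2 • (C0ᵀ * (Aᵀ) ^ D * Q * A ^ D * C0)) Z).PosSemidef := by
  have hZt : Zᵀ = Z := by
    simpa only [Matrix.conjTranspose_eq_transpose_of_trivial] using hZ.isHermitian.eq
  have hΨ₁ := posDef_PsiR A Bb C0 Cb σ0 σD (D + 1) hQ.posSemidef hR hZ.posSemidef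
  have hΨ₀ := posDef_PsiR A Bb C0 Cb σ0 σD D hQ.posSemidef hRhat hZ.posSemidef
  have hcongr : ∀ M : Matrix (Fin n) (Fin n) ℝ, M.PosSemidef →
      (Aᵀ * Z * Bb * M * Bbᵀ * Z * A).PosSemidef := by
    intro M hM
    simpa only [Matrix.conjTranspose_eq_transpose_of_trivial, Matrix.transpose_mul,
      Matrix.transpose_transpose, hZt, mul_assoc] using
      hM.conjTranspose_mul_mul_same (Bbᵀ * Z * A)
  have hdom : (Aᵀ * Z * A + Q - Z).PosSemidef := by
    have h := hcongr _ hΨ₁.inv.posSemidef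
    have heq : Aᵀ * Z * A + Q - RopR A Bb C0 Cb σ0 σD Q (D + 1) R Z =
        Aᵀ * Z * Bb * (PsiR A Bb C0 Cb σ0 σD Q (D + 1) R Z)⁻¹ * Bbᵀ * Z * A :=
      sub_sub_cancel _ _
    rwa [← heq, ← hfix] at h
  have hle := posSemidef_inv_sub_inv hΨ₀ hΨ₁ <| by
    rw [PsiR_succ_sub_PsiR]
    exact (posSemidef_smul_transpose_pow_mul A C0 D σ0 hdom).add
      (posSemidef_smul_transpose_pow_mul A Cb D σD hdom)
  have hfinal := hcongr _ hle
  simp only [mul_sub, sub_mul] at hfinal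
  have heq : ∀ W : Matrix (Fin n) (Fin n) ℝ,
      W = RopR A Bb C0 Cb σ0 σD Q (D + 1) R Z →
      W - RopR A Bb C0 Cb σ0 σD Q D (R - σ0 ^ 2 • (C0ᵀ * (Aᵀ) ^ D * Q * A ^ D * C0)) Z =
        Aᵀ * Z * Bb * (PsiR A Bb C0 Cb σ0 σD Q D
          (R - σ0 ^ 2 • (C0ᵀ * (Aᵀ) ^ D * Q * A ^ D * C0)) Z)⁻¹ * Bbᵀ * Z * A -
        Aᵀ * Z * Bb * (PsiR A Bb C0 Cb σ0 σD Q (D + 1) R Z)⁻¹ * Bbᵀ * Z * A := by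
    rintro W rfl
    exact sub_sub_sub_cancel_left _ _ _
  rw [heq Z hfix]
  exact hfinal
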